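/- arXiv:1711.02822 — 4 statements merged into one kernel-verified Lean document; each statement's English description precedes it below -/
import Mathlib

section
/- Let k be an odd positive integer such that D := k² + 4 is squarefree. Then the following are equivalent: (i) there exist integers a, b, c with b² − 4ac = D such that for all integers (x, y) ≠ (0, 0) the value 2a·x² + 2b·x·y + 2c·y² is neither 0 nor −2; (ii) the class number of the real quadratic field ℚ(√D) is greater than 1. -/
open NumberField Polynomial

section QuadraticOrder

variable {R : Type*} [CommRing R] {k : ℤ} {ω : R}

/-- If `R = ℤ[ω]` with `ω² = kω + 1` is a principal ideal ring, then every binary quadratic form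
of discriminant `k² + 4` with nonzero leading coefficient represents `1` or `-1`. -/
theorem form_represents_unit_of_isPrincipalIdealRing [IsPrincipalIdealRing R]
    (hω : ω ^ 2 = k * ω + 1) (hspan : ∀ z : R, ∃ u v : ℤ, z = u + v * ω)
    (hind : ∀ u v : ℤ, (u + v * ω : R) = 0 → u = 0 ∧ v = 0)
    {a m c : ℤ} (ha : a ≠ 0) (hac : a * c = m ^ 2 + k * m - 1) :
    ∃ x y : ℤ, IsUnit (a * x ^ 2 + (2 * m + k) * x * y + c * y ^ 2) := by
  have hacR : (a * c : R) = m ^ 2 + k * m - 1 := by exact_mod_cast congrArg (Int.cast : ℤ → R) hac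
  obtain ⟨g, hg⟩ := IsPrincipalIdealRing.principal (Ideal.span {(a : R), m + ω})
  rw [Ideal.submodule_span_eq] at hg
  have hgmem : g ∈ Ideal.span {(a : R), m + ω} := hg ▸ Ideal.mem_span_singleton_self g
  have hamem : (a : R) ∈ Ideal.span {g} := hg ▸ Ideal.subset_span (by simp)
  have hθmem : (m + ω : R) ∈ Ideal.span {g} := hg ▸ Ideal.subset_span (by simp)
  obtain ⟨r, s, hrs⟩ := Ideal.mem_span_pair.mp hgmem
  obtain ⟨β, hβ⟩ := Ideal.mem_span_singleton.mp hamem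
  obtain ⟨γ, hγ⟩ := Ideal.mem_span_singleton.mp hθmem
  obtain ⟨r₀, r₁, rfl⟩ := hspan r
  obtain ⟨s₀, s₁, rfl⟩ := hspan s
  obtain ⟨β₀, β₁, rfl⟩ := hspan β
  obtain ⟨γ₀, γ₁, rfl⟩ := hspan γ
  obtain ⟨x, y, hxy⟩ : ∃ x y : ℤ, g = a * x + (m + ω) * y := by
    refine ⟨r₀ - m * r₁ - c * s₁, a * r₁ + s₀ + (m + k) * s₁, ?_⟩
    push_cast
    linear_combination -hrs + (s₁ : R) * hω + (s₁ : R) * hacR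
  have hgω : g * ω = a * (-c * y - m * x) + (m + ω) * (a * x + (m + k) * y) := by
    linear_combination ω * hxy + (y : R) * hω + (y : R) * hacR
  have hcoord : ∀ p q : ℤ, (a * p + (m + ω) * q : R) = 0 → p = 0 ∧ q = 0 := by
    intro p q h
    obtain ⟨h₁, rfl⟩ := hind (a * p + m * q) q (by push_cast; linear_combination h)
    simpa [ha] using h₁
  obtain ⟨e₁, e₂⟩ := hcoord (β₀ * x + β₁ * (-c * y - m * x) - 1)
    (β₀ * y + β₁ * (a * x + (m + k) * y)) (by
      push_cast; linear_combination -hβ - (β₀ : R) * hxy - (β₁ : R) * hgω)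
  obtain ⟨e₃, e₄⟩ := hcoord (γ₀ * x + γ₁ * (-c * y - m * x))
    (γ₀ * y + γ₁ * (a * x + (m + k) * y) - 1) (by
      push_cast; linear_combination -hγ - (γ₀ : R) * hxy - (γ₁ : R) * hgω)
  refine ⟨x, y, IsUnit.of_mul_eq_one (β₀ * γ₁ - β₁ * γ₀) ?_⟩
  have h := congrArg₂ (· * ·) (sub_eq_zero.mp e₁) (sub_eq_zero.mp e₄)
  simp only [mul_one] at h
  linear_combination h - (γ₀ * x + γ₁ * (-c * y - m * x)) * e₂

/-- If every form of discriminant `k² + 4` represents `-1`, then every ideal of `R = ℤ[ω]`, where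
`ω² = kω + 1`, is principal. -/
theorem isPrincipalIdealRing_of_form_represents_neg_one
    (hω : ω ^ 2 = k * ω + 1) (hspan : ∀ z : R, ∃ u v : ℤ, z = u + v * ω)
    (hform : ∀ a m c : ℤ, a * c = m ^ 2 + k * m - 1 →
      ∃ x y : ℤ, a * x ^ 2 + (2 * m + k) * x * y + c * y ^ 2 = -1) :
    IsPrincipalIdealRing R := by
  refine ⟨fun I => ?_⟩
  let J : Ideal ℤ :=
    { carrier := {v | ∃ u : ℤ, (u + v * ω : R) ∈ I}
      zero_mem' := ⟨0, by simp⟩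
      add_mem' := by
        rintro v v' ⟨u, hu⟩ ⟨u', hu'⟩
        refine ⟨u + u', ?_⟩
        convert I.add_mem hu hu' using 1
        push_cast; ring
      smul_mem' := by
        rintro t v ⟨u, hu⟩
        refine ⟨t * u, ?_⟩
        convert I.mul_mem_left (t : R) hu using 1
        push_cast [smul_eq_mul]; ring }
  obtain ⟨n, hn⟩ := IsPrincipalIdealRing.principal J
  obtain ⟨A, hA⟩ := IsPrincipalIdealRing.principal (I.comap (Int.castRingHom R))
  rw [Ideal.submodule_span_eq] at hn hA
  have hJ : ∀ u v : ℤ, (u + v * ω : R) ∈ I → n ∣ v := fun u v h => by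
    rw [← Ideal.mem_span_singleton, ← hn]
    exact ⟨u, h⟩
  have hI : ∀ u : ℤ, (u : R) ∈ I ↔ A ∣ u := fun u => by
    rw [← Ideal.mem_span_singleton, ← hA]
    simp
  have hcoeff : ∀ u v : ℤ, (u + v * ω : R) ∈ I → n ∣ u := fun u v h => by
    have := hJ v (u + v * k) (by
      convert I.mul_mem_left ω h using 1
      push_cast; linear_combination -(v : R) * hω)
    simpa using (dvd_sub this ((hJ u v h).mul_right k))
  rcases eq_or_ne n 0 with rfl | hn0
  · suffices I = ⊥ from this ▸ inferInstance
    refine (Submodule.eq_bot_iff _).mpr fun z hz => ?_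
    obtain ⟨u, v, rfl⟩ := hspan z
    simp [zero_dvd_iff.mp (hJ u v hz), zero_dvd_iff.mp (hcoeff u v hz)]
  obtain ⟨u₀, hu₀⟩ : n ∈ J := hn ▸ Ideal.mem_span_singleton_self n
  obtain ⟨m, rfl⟩ := hcoeff _ _ hu₀
  obtain ⟨a, rfl⟩ : n ∣ A := hcoeff A 0 (by simpa using (hI A).mpr dvd_rfl)
  obtain ⟨c, hc⟩ : n * a ∣ n * (m ^ 2 + k * m - 1) := (hI _).mp (by
    convert I.mul_mem_left (m + k - ω) hu₀ using 1
    push_cast; linear_combination (n : R) * hω)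
  have hac : a * c = m ^ 2 + k * m - 1 := mul_left_cancel₀ hn0 (by linarith)
  obtain ⟨x, y, hxy⟩ := hform a m c hac
  have hacR : (a * c : R) = m ^ 2 + k * m - 1 := by exact_mod_cast congrArg (Int.cast : ℤ → R) hac
  have hxyR : (a * x ^ 2 + (2 * m + k) * x * y + c * y ^ 2 : R) = -1 := by
    exact_mod_cast congrArg (Int.cast : ℤ → R) hxy
  refine ⟨n * (a * x + (m + ω) * y), le_antisymm (fun z hz => ?_) ?_⟩
  · obtain ⟨u, v, rfl⟩ := hspan z
    obtain ⟨w, rfl⟩ := hJ u v hz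
    obtain ⟨t, ht⟩ : n * a ∣ u - w * (n * m) := (hI _).mp (by
      convert I.sub_mem hz (I.mul_mem_left (w : R) hu₀) using 1
      push_cast; ring)
    have htR : (u - w * (n * m) : R) = n * a * t := by
      exact_mod_cast congrArg (Int.cast : ℤ → R) ht
    refine Ideal.mem_span_singleton.mpr
      ⟨-(a * x + (m + k - ω) * y) * t - (x * (m + ω) + c * y) * w, ?_⟩
    push_cast
    linear_combination htR + (n * a * t + n * w * (m + ω) : R) * hxyR +
      (n * w * x * y - n * t * y ^ 2 : R) * (hω + hacR)
  · rw [Ideal.submodule_span_eq, Ideal.span_singleton_le_iff_mem]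
    have := I.add_mem (I.mul_mem_right (x : R) ((hI (n * a)).mpr dvd_rfl))
      (I.mul_mem_right (y : R) hu₀)
    convert this using 1
    push_cast; ring

end QuadraticOrder

/-- A form of discriminant `k² + 4` representing a unit represents `-1`, since `ℤ[ω]` has a unit of
norm `-1`. -/
theorem form_represents_neg_one {k a m c x y : ℤ} (hac : a * c = m ^ 2 + k * m - 1)
    (h : IsUnit (a * x ^ 2 + (2 * m + k) * x * y + c * y ^ 2)) :
    ∃ x y : ℤ, a * x ^ 2 + (2 * m + k) * x * y + c * y ^ 2 = -1 := by
  rcases Int.isUnit_iff.mp h with h | h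
  · refine ⟨-c * y - m * x, a * x + (m + k) * y, ?_⟩
    linear_combination (a * x ^ 2 + (2 * m + k) * x * y + c * y ^ 2) * hac - h
  · exact ⟨x, y, h⟩

theorem Squarefree.exists_int_eq_of_sq_mul {D s : ℤ} (hD : Squarefree D) {q : ℚ}
    (h : q ^ 2 * D = s) : ∃ n : ℤ, q = n := by
  have hden : (q.den : ℚ) ≠ 0 := by exact_mod_cast q.den_nz
  have h' : q.num ^ 2 * D = s * (q.den : ℤ) ^ 2 := by
    rw [← Rat.num_div_den q] at h
    field_simp at h
    have : (q.num ^ 2 * D : ℚ) = s * (q.den : ℚ) ^ 2 := by linear_combination h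
    exact_mod_cast this
  have hcop : IsCoprime ((q.den : ℤ) ^ 2) (q.num ^ 2) :=
    (Int.isCoprime_iff_gcd_eq_one.mpr (by
      rw [Int.gcd_comm]; simpa [Int.gcd] using q.reduced)).pow
  have hdvd : (q.den : ℤ) * q.den ∣ D := by
    rw [← sq]
    exact hcop.dvd_of_dvd_mul_left (h' ▸ dvd_mul_left _ _)
  have h1 : q.den = 1 := by simpa using Int.isUnit_iff_natAbs_eq.mp (hD _ hdvd)
  exact ⟨q.num, ((Rat.den_eq_one_iff q).mp h1).symm⟩

theorem Squarefree.ratCast_sq_ne {D : ℤ} (hD : Squarefree D) (h1 : D ≠ 1) (q : ℚ) :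
    q ^ 2 ≠ D := by
  intro h
  obtain ⟨n, rfl⟩ := squarefree_one.exists_int_eq_of_sq_mul (s := D) (by simpa using h)
  have h' : D = n * n := by rw [← sq]; exact_mod_cast h.symm
  have := Int.isUnit_iff.mp (hD n (h' ▸ dvd_rfl))
  rcases this with rfl | rfl <;> simp_all

/-- A quadratic irrationality which is integral has integral trace and norm. -/
theorem IsIntegral.exists_int_of_quadratic {K : Type*} [Field K] [Algebra ℚ K] {z : K}
    (hz : IsIntegral ℤ z) (hirr : z ∉ (algebraMap ℚ K).range) {t n : ℚ}
    (h : z ^ 2 - algebraMap ℚ K t * z + algebraMap ℚ K n = 0) :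
    (∃ T : ℤ, t = T) ∧ ∃ N : ℤ, n = N := by
  have hzQ : IsIntegral ℚ z := hz.tower_top
  have hmonic : (X ^ 2 - C t * X + C n : ℚ[X]).Monic := by monicity!
  have hdeg : (X ^ 2 - C t * X + C n : ℚ[X]).degree ≤ (minpoly ℚ z).degree := by
    have h2 := (minpoly.two_le_natDegree_iff hzQ).mpr hirr
    rw [degree_eq_natDegree (minpoly.ne_zero hzQ)]
    refine le_trans ?_ (Nat.cast_le.mpr h2)
    compute_degree!
  have hmin := minpoly.unique_of_degree_le_degree_minpoly ℚ z hmonic (by simpa using h) hdeg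
  rw [minpoly.isIntegrallyClosed_eq_field_fractions' ℚ hz] at hmin
  have c₁ := congrArg (coeff · 1) hmin
  have c₀ := congrArg (coeff · 0) hmin
  simp [coeff_X, coeff_C] at c₁ c₀
  exact ⟨⟨-(minpoly ℤ z).coeff 1, by push_cast; linarith⟩, ⟨(minpoly ℤ z).coeff 0, by linarith⟩⟩

/-- The ring of integers of `ℚ(√(k² + 4))` is `ℤ[ω]` with `ω² = kω + 1`. -/
theorem exists_ringOfIntegers_generator {k : ℤ} (hk : Odd k)
    (hsf : Squarefree (k ^ 2 + 4)) (K : Type*) [Field K] [NumberField K]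
    (hrank : Module.finrank ℚ K = 2) (hroot : ∃ x : K, x ^ 2 = ((k ^ 2 + 4 : ℤ) : K)) :
    ∃ ω : 𝓞 K, ω ^ 2 = k * ω + 1 ∧ (∀ z : 𝓞 K, ∃ u v : ℤ, z = u + v * ω) ∧
      ∀ u v : ℤ, (u + v * ω : 𝓞 K) = 0 → u = 0 ∧ v = 0 := by
  obtain ⟨x, hx⟩ := hroot
  have h1 : k ^ 2 + 4 ≠ 1 := (by nlinarith [sq_nonneg k] : (1 : ℤ) < k ^ 2 + 4).ne'
  set w : K := (k + x) / 2 with hw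
  have hw2 : w ^ 2 = k * w + 1 := by
    rw [hw]; push_cast at hx; linear_combination hx / 4
  have hwirr : ∀ q : ℚ, (q : K) ≠ w := by
    intro q hq
    refine hsf.ratCast_sq_ne h1 (2 * q - k) ?_
    have : ((2 * q - k : ℚ) : K) = x := by push_cast; rw [hq, hw]; ring
    have h2 : (((2 * q - k) ^ 2 : ℚ) : K) = ((k ^ 2 + 4 : ℤ) : ℚ) := by
      rw [Rat.cast_pow, this, hx]; norm_cast
    exact_mod_cast h2
  have hind : ∀ p q : ℚ, (p + q * w : K) = 0 → p = 0 ∧ q = 0 := by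
    intro p q h
    rcases eq_or_ne q 0 with rfl | hq
    · simpa using h
    · refine absurd ?_ (hwirr (-p / q))
      have : (q : K) ≠ 0 := by exact_mod_cast hq
      push_cast
      field_simp
      linear_combination -h
  have hli : LinearIndependent ℚ ![(1 : K), w] := by
    refine LinearIndependent.pair_iff.mpr fun p q h => hind p q ?_
    simpa [Rat.smul_def] using h
  have hspan : ∀ z : K, ∃ p q : ℚ, z = p + q * w := by
    intro z
    have hz : z ∈ Submodule.span ℚ (Set.range ![(1 : K), w]) := by
      rw [hli.span_eq_top_of_card_eq_finrank (by simp [hrank])]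
      trivial
    rw [Matrix.range_cons, Matrix.range_cons, Matrix.range_empty, Set.union_empty,
      Set.singleton_union, Submodule.mem_span_pair] at hz
    obtain ⟨p, q, h⟩ := hz
    exact ⟨p, q, by simpa [Rat.smul_def] using h.symm⟩
  have hwint : IsIntegral ℤ w := by
    refine ⟨X ^ 2 - C k * X - C 1, by monicity!, ?_⟩
    rw [← aeval_def]
    simp [hw2]
  obtain ⟨ω, hω⟩ : ∃ ω : 𝓞 K, (ω : K) = w := ⟨⟨w, hwint⟩, rfl⟩
  refine ⟨ω, ?_, fun z => ?_, fun u v h => ?_⟩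
  · apply RingOfIntegers.ext
    simpa [hω] using hw2
  · obtain ⟨p, q, hpq⟩ := hspan z
    suffices ∃ P Q : ℤ, p = P ∧ q = Q by
      obtain ⟨P, Q, rfl, rfl⟩ := this
      refine ⟨P, Q, RingOfIntegers.ext ?_⟩
      simpa [hω] using hpq
    have hzint : IsIntegral ℤ (z : K) := z.isIntegral_coe
    rcases eq_or_ne q 0 with rfl | hq
    · have : IsIntegral ℤ p := by
        rw [← isIntegral_algebraMap_iff (algebraMap ℚ K).injective]
        simpa [hpq] using hzint
      obtain ⟨P, hP⟩ := IsIntegrallyClosed.isIntegral_iff.mp this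
      exact ⟨P, 0, by simpa using hP.symm, by simp⟩
    · obtain ⟨⟨T, hT⟩, N, hN⟩ := hzint.exists_int_of_quadratic (t := 2 * p + q * k)
        (n := p ^ 2 + p * q * k - q ^ 2) (by
          rintro ⟨r, hr⟩
          refine hq (hind (p - r) q ?_).2
          have hr' : (r : K) = z := by simpa using hr
          push_cast
          linear_combination -hr' - hpq) (by
          simp only [eq_ratCast]
          rw [hpq]
          push_cast
          linear_combination (q : K) ^ 2 * hw2)
      obtain ⟨Q, rfl⟩ := hsf.exists_int_eq_of_sq_mul (q := q) (s := T ^ 2 - 4 * N) (by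
        push_cast
        rw [← hT, ← hN]
        ring)
      have hsum : T ^ 2 - 4 * N = Q ^ 2 * (k ^ 2 + 4) := by
        have : (T ^ 2 - 4 * N : ℚ) = Q ^ 2 * (k ^ 2 + 4) := by rw [← hT, ← hN]; ring
        exact_mod_cast this
      have heven : Even (T - Q * k) := by
        have := congrArg Even hsum
        simp [Int.even_sub, Int.even_add, Int.even_mul, Int.even_pow] at this ⊢
        grind
      obtain ⟨P, hP⟩ := heven
      refine ⟨P, Q, ?_, rfl⟩
      have hP' : (T - Q * k : ℚ) = P + P := by exact_mod_cast hP
      linarith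
  · have huv : ((u : ℚ) + (v : ℚ) * w : K) = 0 := by
      simpa [hω] using congrArg (algebraMap (𝓞 K) K) h
    simpa using hind u v huv


/-- For odd `k > 0` with `D = k² + 4` square-free, there is a lattice `L ∈ 𝕃′` with
`disc L = -D` iff the class number of `ℚ(√D)` is greater than `1` (Lemma 2.5 together
with Remark 4.6, using `h⁺(D) = h(D)`). Here `ℚ(√D)` is formalized as any number field
of degree `2` over `ℚ` containing a square root of `D`. -/
theorem stmt13 (k : ℤ) (hk : 0 < k) (hodd : Odd k)
    (D : ℤ) (hD : D = k ^ 2 + 4) (hsf : Squarefree D)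
    (K : Type) [Field K] [NumberField K]
    (hrank : Module.finrank ℚ K = 2) (hroot : ∃ x : K, x ^ 2 = (D : K)) :
    (∃ a b c : ℤ, b ^ 2 - 4 * a * c = D ∧
        ∀ x y : ℤ, (x, y) ≠ (0, 0) →
          2 * a * x ^ 2 + 2 * b * x * y + 2 * c * y ^ 2 ≠ 0 ∧
            2 * a * x ^ 2 + 2 * b * x * y + 2 * c * y ^ 2 ≠ -2) ↔
      1 < NumberField.classNumber K := by
  subst hD
  have h1 : k ^ 2 + 4 ≠ 1 := (by nlinarith [sq_nonneg k] : (1 : ℤ) < k ^ 2 + 4).ne'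
  obtain ⟨ω, hω, hspan, hind⟩ := exists_ringOfIntegers_generator hodd hsf K hrank hroot
  have hclass : 1 < classNumber K ↔ ¬ IsPrincipalIdealRing (𝓞 K) := by
    rw [← classNumber_eq_one_iff]
    have := classNumber_pos K
    omega
  have hns : ∀ n : ℤ, n ^ 2 ≠ k ^ 2 + 4 := fun n h =>
    hsf.ratCast_sq_ne h1 n (by exact_mod_cast h)
  have hb : ∀ {a b c : ℤ}, b ^ 2 - 4 * a * c = k ^ 2 + 4 →
      ∃ m : ℤ, b = 2 * m + k ∧ a * c = m ^ 2 + k * m - 1 := by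
    intro a b c h
    have heven : Even (b - k) := by
      have := congrArg Even h
      simp [Int.even_sub, Int.even_add, Int.even_mul, Int.even_pow] at this ⊢
      grind
    obtain ⟨m, hm⟩ := heven
    obtain rfl : b = 2 * m + k := by linarith
    exact ⟨m, rfl, by linarith⟩
  rw [hclass]
  constructor
  · rintro ⟨a, b, c, habc, hrep⟩ hprin
    have ha : a ≠ 0 := by
      rintro rfl
      exact hns b (by simpa using habc)
    obtain ⟨m, rfl, hac⟩ := hb habc
    obtain ⟨x, y, hxy⟩ := form_represents_unit_of_isPrincipalIdealRing hω hspan hind ha hac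
    obtain ⟨x, y, hxy⟩ := form_represents_neg_one hac hxy
    refine (hrep x y ?_).2 (by linear_combination 2 * hxy)
    rintro ⟨⟩
    simp at hxy
  · contrapose!
    intro hno
    refine isPrincipalIdealRing_of_form_represents_neg_one hω hspan fun a m c hac => ?_
    have habc : (2 * m + k) ^ 2 - 4 * a * c = k ^ 2 + 4 := by linear_combination -4 * hac
    obtain ⟨x, y, hxy, h⟩ := hno a (2 * m + k) c habc
    refine ⟨x, y, ?_⟩
    by_cases h0 : 2 * a * x ^ 2 + 2 * (2 * m + k) * x * y + 2 * c * y ^ 2 = 0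
    · exfalso
      have hsq : (2 * a * x + (2 * m + k) * y) ^ 2 = y ^ 2 * (k ^ 2 + 4) := by
        linear_combination 2 * a * h0 + y ^ 2 * habc
      rcases eq_or_ne y 0 with rfl | hy
      · have ha : a = 0 := by
          have hx : x ≠ 0 := by rintro rfl; simp at hxy
          simpa [hx] using hsq
        subst ha
        exact hns (2 * m + k) (by simpa using habc)
      · obtain ⟨n, hn⟩ : y ∣ 2 * a * x + (2 * m + k) * y :=
          (Int.pow_dvd_pow_iff two_ne_zero).mp ⟨_, hsq⟩
        rw [hn, mul_pow] at hsq
        exact hns n (mul_left_cancel₀ (pow_ne_zero 2 hy) hsq)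
    · linarith [h h0]
end

section
/- Let Δ > 2 be an integer that is not a perfect square, and let (a₁, a₂, a₃, …) be the sequence of partial quotients (after the integer part a₀) of the simple continued fraction expansion of √Δ; this sequence is periodic, i.e. there is a positive integer p with a_{n+p} = a_n for all n ≥ 1. The least such p is even if and only if at least one of the following holds: (1) there is a factorization Δ = a·b with 1 < a < b such that a·x² − b·y² = 1 or a·x² − b·y² = −1 has an integer solution (x, y); (2) there is a factorization Δ = a·b with 1 ≤ a < b such that a·x² − b·y² = 2 or a·x² − b·y² = −2 has an integer solution (x, y) with x·y odd. -/
open GenContFract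

/-- The shift of the continued fraction expansion, sending a complete quotient to the next one. -/
noncomputable def contFracShift (x : ℝ) : ℝ := (Int.fract x)⁻¹

theorem irrational_contFracShift {x : ℝ} (hx : Irrational x) : Irrational (contFracShift x) := by
  unfold contFracShift
  rw [irrational_inv_iff, ← Int.self_sub_floor]
  exact hx.sub_intCast _

theorem irrational_iterate_contFracShift {x : ℝ} (hx : Irrational x) (n : ℕ) :
    Irrational (contFracShift^[n] x) := by
  induction n generalizing x with
  | zero => exact hx
  | succ n ih => exact ih (irrational_contFracShift hx)

theorem fract_pos_of_irrational {x : ℝ} (hx : Irrational x) : 0 < Int.fract x :=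
  Int.fract_pos.2 (hx.ne_int _)

theorem one_lt_contFracShift {x : ℝ} (hx : Irrational x) : 1 < contFracShift x :=
  (one_lt_inv₀ (fract_pos_of_irrational hx)).2 (Int.fract_lt_one x)

theorem eq_floor_add_inv_contFracShift (x : ℝ) : x = ⌊x⌋ + (contFracShift x)⁻¹ := by
  simp [contFracShift]

theorem partDens_of_irrational {x : ℝ} (hx : Irrational x) (n : ℕ) :
    (GenContFract.of x).partDens.get? n = some (⌊contFracShift^[n + 1] x⌋ : ℝ) := by
  suffices h : (GenContFract.of x).s.get? n = some ⟨1, (⌊contFracShift^[n + 1] x⌋ : ℝ)⟩ by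
    exact GenContFract.partDen_eq_s_b h
  induction n generalizing x with
  | zero => exact GenContFract.of_s_head (fract_pos_of_irrational hx).ne'
  | succ n ih =>
    rw [GenContFract.of_s_succ]
    exact ih (irrational_contFracShift hx)

theorem convergent_eq_of_floor_iterate_eq {x y : ℝ}
    (h : ∀ n, ⌊contFracShift^[n] x⌋ = ⌊contFracShift^[n] y⌋) (n : ℕ) :
    x.convergent n = y.convergent n := by
  induction n generalizing x y with
  | zero => simpa using h 0
  | succ n ih =>
    have h0 : ⌊x⌋ = ⌊y⌋ := h 0
    rw [Real.convergent_succ, Real.convergent_succ, h0]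
    congr 2
    exact ih fun m => h (m + 1)

/-- A real number is determined by its partial quotients. -/
theorem eq_of_floor_iterate_contFracShift_eq {x y : ℝ}
    (h : ∀ n, ⌊contFracShift^[n] x⌋ = ⌊contFracShift^[n] y⌋) : x = y := by
  refine tendsto_nhds_unique (GenContFract.of_convergence x) ?_
  have : (GenContFract.of x).convs = (GenContFract.of y).convs := by
    funext n
    rw [Real.convs_eq_convergent, Real.convs_eq_convergent, convergent_eq_of_floor_iterate_eq h]
  rw [this]
  exact GenContFract.of_convergence y

/-- Consecutive continuants `h / k` and `h' / k'` of an irrational number. -/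
theorem exists_continuants {x : ℝ} (hx : Irrational x) (n : ℕ) :
    ∃ h h' k k' : ℤ, 0 < k ∧ 0 ≤ k' ∧ h * k' - h' * k = (-1) ^ (n + 1) ∧
      x * (k * contFracShift^[n + 1] x + k') = h * contFracShift^[n + 1] x + h' ∧
      x.convergent n = h / k ∧ (1 < x → 0 < h ∧ 0 ≤ h') := by
  induction n generalizing x with
  | zero =>
    have hT : contFracShift x ≠ 0 := (zero_lt_one.trans (one_lt_contFracShift hx)).ne'
    refine ⟨⌊x⌋, 1, 1, 0, one_pos, le_rfl, by simp, ?_, by simp, fun h1 => ⟨?_, zero_le_one⟩⟩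
    · have := eq_floor_add_inv_contFracShift x
      simp only [zero_add, Function.iterate_one, Int.cast_one, Int.cast_zero]
      nth_rw 1 [this]
      field_simp
      ring
    · exact Int.floor_pos.2 h1.le
  | succ n ih =>
    have hT1 := one_lt_contFracShift hx
    have hT : contFracShift x ≠ 0 := (zero_lt_one.trans hT1).ne'
    obtain ⟨h, h', k, k', hk, hk', hdet, hxe, hconv, hpos⟩ := ih (irrational_contFracShift hx)
    obtain ⟨hh, hh'⟩ := hpos hT1
    refine ⟨⌊x⌋ * h + k, ⌊x⌋ * h' + k', h, h', hh, hh', ?_, ?_, ?_, fun h1 => ?_⟩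
    · rw [pow_succ, ← hdet]; ring
    · have := eq_floor_add_inv_contFracShift x
      rw [Function.iterate_succ_apply]
      nth_rw 1 [this]
      push_cast
      rw [← hxe]
      field_simp
      linear_combination (⌊x⌋ : ℝ) * hxe
    · rw [Real.convergent_succ]
      change _ + ((contFracShift x).convergent n)⁻¹ = _
      rw [hconv]
      have : (h : ℚ) ≠ 0 := by exact_mod_cast hh.ne'
      push_cast
      field_simp
    · have : 0 < ⌊x⌋ := Int.floor_pos.2 h1.le
      constructor <;> positivity

/-- Comparing rational and irrational parts of a linear relation over `ℤ`. -/
theorem eq_zero_of_add_mul_irrational {x : ℝ} (hx : Irrational x) {a b : ℤ}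
    (h : (a : ℝ) + b * x = 0) : a = 0 ∧ b = 0 := by
  have hb : b = 0 := by
    by_contra hb
    exact ((hx.intCast_mul hb).intCast_add a).ne_zero h
  subst hb
  simpa using h

section Pell

variable {Δ : ℤ}

theorem norm_eq_neg_one_pow_of_period (hΔ : 0 < Δ) (hirr : Irrational √(Δ : ℝ)) {p : ℕ}
    (h : contFracShift^[p + 1] √(Δ : ℝ) = contFracShift √(Δ : ℝ)) :
    ∃ r s : ℤ, r ^ 2 - Δ * s ^ 2 = (-1) ^ p := by
  obtain ⟨u, u', k, k', -, -, hdet, hx, -, -⟩ := exists_continuants hirr p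
  rw [h] at hx
  have hT : contFracShift √(Δ : ℝ) ≠ 0 :=
    (zero_lt_one.trans (one_lt_contFracShift hirr)).ne'
  have hfl := eq_floor_add_inv_contFracShift √(Δ : ℝ)
  have hsq : √(Δ : ℝ) ^ 2 = Δ := Real.sq_sqrt (by exact_mod_cast hΔ.le)
  set a := ⌊√(Δ : ℝ)⌋
  set w := √(Δ : ℝ)
  set t := contFracShift w
  have hti : t * (w - a) = 1 := by
    rw [hfl]
    field_simp
    ring
  have hlin : ((k' * Δ - u + a * u' : ℤ) : ℝ) + (k - a * k' - u' : ℤ) * w = 0 := by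
    push_cast
    linear_combination (w - a) * hx - (w * k - u) * hti - k' * hsq
  obtain ⟨h1, h2⟩ := eq_zero_of_add_mul_irrational hirr hlin
  refine ⟨u', k', ?_⟩
  rw [pow_succ] at hdet
  linear_combination -hdet - k' * h1 - u' * h2

theorem exists_odd_period_of_negative_pell (hΔ : 2 < Δ) (hirr : Irrational √(Δ : ℝ))
    {r s : ℤ} (h : r ^ 2 - Δ * s ^ 2 = -1) :
    ∃ q : ℕ, Odd q ∧ contFracShift^[q + 1] √(Δ : ℝ) = contFracShift √(Δ : ℝ) := by
  wlog hr : 0 ≤ r generalizing r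
  · exact this (r := -r) (by linear_combination h) (by lia)
  wlog hs : 0 ≤ s generalizing s
  · exact this (s := -s) (by linear_combination h) (by lia)
  have hs0 : 0 < s := by
    refine hs.lt_of_ne ?_
    rintro rfl
    nlinarith
  have hrs : s < r := by nlinarith
  have hcop : IsCoprime r s := ⟨-r, Δ * s, by linear_combination -h⟩
  have hsq : √(Δ : ℝ) ^ 2 = Δ := Real.sq_sqrt (by exact_mod_cast (by lia : 0 ≤ Δ))
  have hwpos : 1 < √(Δ : ℝ) := by
    rw [Real.lt_sqrt zero_le_one]
    exact_mod_cast (by lia : (1 : ℤ) ^ 2 < Δ)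
  have hnum : ((r : ℚ) / s).num = r :=
    Rat.num_div_eq_of_coprime hs0 (Int.isCoprime_iff_nat_coprime.1 hcop)
  have hden : (((r : ℚ) / s).den : ℤ) = s :=
    Rat.den_div_eq_of_coprime hs0 (Int.isCoprime_iff_nat_coprime.1 hcop)
  have hsR : (0 : ℝ) < s := by exact_mod_cast hs0
  have hrsR : (s : ℝ) < r := by exact_mod_cast hrs
  have hR : (r : ℝ) ^ 2 - Δ * s ^ 2 = -1 := by exact_mod_cast h
  have hlt : |√(Δ : ℝ) - ((r : ℚ) / s : ℚ)| < 1 / (2 * (((r : ℚ) / s).den : ℝ) ^ 2) := by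
    have hden' : (((r : ℚ) / s).den : ℝ) = s := by exact_mod_cast hden
    rw [hden']
    push_cast
    have hle : 1 < (r : ℝ) / s := (one_lt_div hsR).2 hrsR
    have hprod : (√(Δ : ℝ) - r / s) * (√(Δ : ℝ) + r / s) = 1 / s ^ 2 := by
      field_simp
      linear_combination (s : ℝ) ^ 2 * hsq - hR
    have hs2 : (0 : ℝ) < 1 / s ^ 2 := by positivity
    have hd : 0 < √(Δ : ℝ) - r / s := by
      by_contra hneg
      nlinarith
    rw [abs_of_pos hd]
    have : 1 / (2 * (s : ℝ) ^ 2) = (1 / s ^ 2) / 2 := by field_simp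
    rw [this, ← hprod]
    nlinarith
  obtain ⟨n, hn⟩ := Real.exists_rat_eq_convergent hlt
  obtain ⟨u, u', k, k', hk, hk', hdet, hx, hconv, -⟩ := exists_continuants hirr n
  have hcop' : IsCoprime u k := by
    refine ⟨(-1) ^ (n + 1) * k', -(-1) ^ (n + 1) * u', ?_⟩
    have : ((-1 : ℤ) ^ (n + 1)) * (-1) ^ (n + 1) = 1 := by rw [← mul_pow]; simp
    linear_combination (-1) ^ (n + 1) * hdet + this
  have hu : u = r := by
    rw [← hnum, hn, hconv]
    exact (Rat.num_div_eq_of_coprime hk (Int.isCoprime_iff_nat_coprime.1 hcop')).symm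
  have hks : k = s := by
    rw [← hden, hn, hconv]
    exact (Rat.den_div_eq_of_coprime hk (Int.isCoprime_iff_nat_coprime.1 hcop')).symm
  subst hu hks
  have ht : 1 < contFracShift^[n + 1] √(Δ : ℝ) := by
    rw [Function.iterate_succ_apply']
    exact one_lt_contFracShift (irrational_iterate_contFracShift hirr n)
  set w := √(Δ : ℝ) with hw
  set t := contFracShift^[n + 1] w with ht_def
  have hdetR : (u : ℝ) * k' - u' * k = (-1) ^ (n + 1) := by exact_mod_cast hdet
  have hk'R : (0 : ℝ) ≤ k' := by exact_mod_cast hk'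
  have hev : Even n := by
    by_contra hodd
    rw [Nat.not_even_iff_odd] at hodd
    rw [hodd.add_one.neg_one_pow] at hdetR
    have hden0 : 0 < (k : ℝ) * t + k' := by positivity
    have hd : (w * k - u) * (k * t + k') = -1 := by linear_combination k * hx - hdetR
    have hd2 : (w * k - u) * (w * k + u) = 1 := by
      linear_combination (k : ℝ) ^ 2 * hsq - hR
    have hp : 0 < w * k + u := by positivity
    nlinarith
  refine ⟨n + 1, hev.add_one, ?_⟩
  rw [hev.add_one.neg_one_pow] at hdetR
  rw [Function.iterate_succ_apply', ← ht_def]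
  have htw : t = w + (u * u' - Δ * k * k' : ℤ) := by
    push_cast
    linear_combination (w * k + u) * hx - w * hdetR - (k ^ 2 * t + k * k') * hsq + t * hR
  rw [htw, contFracShift, Int.fract_add_intCast, contFracShift]

/-- If the negative Pell equation is solvable, then every solution of the Pell equation with
positive first coordinate is the square of a unit. -/
theorem exists_sq_of_negative_pell (hΔ : 1 < Δ) (hns : ¬IsSquare Δ) {r s : ℤ}
    (h : r ^ 2 - Δ * s ^ 2 = -1) {x y : ℤ} (hxy : x ^ 2 - Δ * y ^ 2 = 1) (hx : 0 < x) :
    ∃ c d : ℤ, (c ^ 2 - Δ * d ^ 2 = 1 ∨ c ^ 2 - Δ * d ^ 2 = -1) ∧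
      x = c ^ 2 + Δ * d ^ 2 ∧ y = 2 * c * d := by
  obtain ⟨e, he⟩ := Pell.IsFundamental.exists_of_not_isSquare (by lia : 0 < Δ) hns
  have key (b : Pell.Solution₁ Δ) (hb : 0 < b.x) : ∃ n : ℤ, b = e ^ n := by
    obtain ⟨n, hn | hn⟩ := he.eq_zpow_or_neg_zpow b
    · exact ⟨n, hn⟩
    · have := Pell.Solution₁.x_zpow_pos he.x_pos n
      rw [hn, Pell.Solution₁.x_neg] at hb
      lia
  have hs : s ≠ 0 := by
    rintro rfl
    nlinarith
  have hs2 : 0 < s ^ 2 := by positivity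
  obtain ⟨m, hm⟩ := key (.mk (r ^ 2 + Δ * s ^ 2) (2 * r * s)
    (by linear_combination (r ^ 2 - Δ * s ^ 2 - 1) * h)) (by simp only [Pell.Solution₁.x_mk]; nlinarith)
  obtain ⟨n, hn⟩ := key (.mk x y hxy) hx
  have sq_x (j : ℤ) : (e ^ (j + j)).x = (e ^ j).x ^ 2 + Δ * (e ^ j).y ^ 2 := by
    rw [zpow_add, Pell.Solution₁.x_mul]; ring
  have sq_y (j : ℤ) : (e ^ (j + j)).y = 2 * (e ^ j).x * (e ^ j).y := by
    rw [zpow_add, Pell.Solution₁.y_mul]; ring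
  have hmx := congrArg Pell.Solution₁.x hm
  have hmy := congrArg Pell.Solution₁.y hm
  have hnx := congrArg Pell.Solution₁.x hn
  have hny := congrArg Pell.Solution₁.y hn
  simp only [Pell.Solution₁.x_mk, Pell.Solution₁.y_mk] at hmx hmy hnx hny
  have hmodd : Odd m := by
    rw [← Int.not_even_iff_odd]
    rintro ⟨j, rfl⟩
    rw [sq_x] at hmx
    have h1 := (e ^ j).prop
    have h2 : ((e ^ j).x - r) * ((e ^ j).x + r) = 1 := by linarith
    have h3 : r = 0 := by rcases Int.mul_eq_one_iff_eq_one_or_neg_one.1 h2 with h | h <;> lia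
    subst h3
    nlinarith
  rcases Int.even_or_odd n with ⟨j, rfl⟩ | hnodd
  · exact ⟨_, _, Or.inl (e ^ j).prop, hnx.trans (sq_x j), hny.trans (sq_y j)⟩
  · obtain ⟨j, hj⟩ := hnodd.sub_odd hmodd
    obtain rfl : n = m + (j + j) := by lia
    rw [zpow_add, Pell.Solution₁.x_mul, ← hmx, ← hmy, sq_x, sq_y] at hnx
    rw [zpow_add, Pell.Solution₁.y_mul, ← hmx, ← hmy, sq_x, sq_y] at hny
    have hj := (e ^ j).prop
    refine ⟨r * (e ^ j).x + Δ * s * (e ^ j).y, r * (e ^ j).y + s * (e ^ j).x, Or.inr ?_, ?_, ?_⟩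
    · linear_combination ((e ^ j).x ^ 2 - Δ * (e ^ j).y ^ 2) * h - hj
    · linear_combination hnx
    · linear_combination hny

/-- Splitting `m * n = Δ * u ^ 2` along coprime positive factors. -/
theorem exists_factorization_of_coprime_mul_eq {m n u : ℤ} (hm : 0 < m) (hn : 0 < n)
    (hmn : IsCoprime m n) (hu : u ≠ 0) (h : m * n = Δ * u ^ 2) :
    ∃ a b x y : ℤ, 0 < a ∧ 0 < b ∧ m = a * x ^ 2 ∧ n = b * y ^ 2 ∧ Δ = a * b ∧
      (u = x * y ∨ u = -(x * y)) := by
  have hxy : (Int.gcd u m : ℤ) * Int.gcd u n = |u| := by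
    have h1 : Nat.gcd u.natAbs (m.natAbs * n.natAbs) = Nat.gcd u.natAbs m.natAbs *
      Nat.gcd u.natAbs n.natAbs := Nat.Coprime.gcd_mul _ (Int.isCoprime_iff_nat_coprime.1 hmn)
    rw [← Int.natAbs_mul, h, Nat.gcd_eq_left
      (Int.natAbs_dvd_natAbs.2 ⟨Δ * u, by ring⟩)] at h1
    rw [Int.abs_eq_natAbs, h1]
    rfl
  have hxm : (Int.gcd u m : ℤ) ∣ m := Int.gcd_dvd_right _ _
  have hyn : (Int.gcd u n : ℤ) ∣ n := Int.gcd_dvd_right _ _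
  have hxu : (Int.gcd u m : ℤ) ∣ u := Int.gcd_dvd_left _ _
  have hyu : (Int.gcd u n : ℤ) ∣ u := Int.gcd_dvd_left _ _
  generalize (Int.gcd u m : ℤ) = x at *
  generalize (Int.gcd u n : ℤ) = y at *
  have hx2 : x ^ 2 ∣ m := by
    refine ((hmn.of_isCoprime_of_dvd_left hxm).pow_left (m := 2)).dvd_of_dvd_mul_right ?_
    rw [h]
    exact (pow_dvd_pow_of_dvd hxu 2).mul_left _
  have hy2 : y ^ 2 ∣ n := by
    refine ((hmn.symm.of_isCoprime_of_dvd_left hyn).pow_left (m := 2)).dvd_of_dvd_mul_left ?_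
    rw [h]
    exact (pow_dvd_pow_of_dvd hyu 2).mul_left _
  obtain ⟨a, rfl⟩ := hx2
  obtain ⟨b, rfl⟩ := hy2
  have hu2 : u ^ 2 = (x * y) ^ 2 := by rw [hxy, sq_abs]
  refine ⟨a, b, x, y, pos_of_mul_pos_right hm (sq_nonneg x),
    pos_of_mul_pos_right hn (sq_nonneg y), mul_comm _ _, mul_comm _ _, ?_, sq_eq_sq_iff_eq_or_eq_neg.1 hu2⟩
  refine mul_right_cancel₀ (pow_ne_zero 2 hu) ?_
  rw [← h, hu2]
  ring

/-- Solvability of the two families of equations in Mordell's criterion. -/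
theorem solvable_of_not_negative_pell (hΔ : 2 < Δ) (hns : ¬IsSquare Δ)
    (hneg : ¬∃ r s : ℤ, r ^ 2 - Δ * s ^ 2 = -1) :
    (∃ a b : ℤ, Δ = a * b ∧ 1 < a ∧ a < b ∧
      ∃ x y : ℤ, a * x ^ 2 - b * y ^ 2 = 1 ∨ a * x ^ 2 - b * y ^ 2 = -1) ∨
    (∃ a b : ℤ, Δ = a * b ∧ 1 ≤ a ∧ a < b ∧
      ∃ x y : ℤ, (a * x ^ 2 - b * y ^ 2 = 2 ∨ a * x ^ 2 - b * y ^ 2 = -2) ∧ Odd (x * y)) := by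
  have two {a b x y : ℤ} (hab : Δ = a * b) (ha : 0 < a) (hb : 0 < b)
      (h : a * x ^ 2 - b * y ^ 2 = 2) (hodd : Odd (x * y)) :
      ∃ a b : ℤ, Δ = a * b ∧ 1 ≤ a ∧ a < b ∧ ∃ x y : ℤ,
        (a * x ^ 2 - b * y ^ 2 = 2 ∨ a * x ^ 2 - b * y ^ 2 = -2) ∧ Odd (x * y) := by
    rcases lt_trichotomy a b with hlt | rfl | hlt
    · exact ⟨a, b, hab, ha, hlt, x, y, Or.inl h, hodd⟩
    · exact absurd ⟨a, hab⟩ hns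
    · exact ⟨b, a, by rw [hab, mul_comm], hb, hlt, y, x, Or.inr (by linarith),
        by rwa [mul_comm]⟩
  obtain ⟨e, h1, hy, hmin⟩ := Pell.IsFundamental.exists_of_not_isSquare (by lia : 0 < Δ) hns
  have hprop := e.prop
  have hmin' (c d : ℤ) (h : c ^ 2 - Δ * d ^ 2 = 1) (hc : 1 < c) : e.x ≤ c :=
    hmin (b := .mk c d h) hc
  clear hmin
  generalize e.x = t at *
  generalize e.y = u at *
  rcases Int.even_or_odd t with ht | ht
  · right
    obtain ⟨j, hj⟩ := ht
    obtain ⟨a, b, x, y, ha, hb, hm, hn, hab, -⟩ := exists_factorization_of_coprime_mul_eq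
      (m := t + 1) (n := t - 1) (u := u) (Δ := Δ) (by lia) (by lia)
      ⟨1 - j, j, by rw [hj]; ring⟩ hy.ne' (by linear_combination hprop)
    have hxodd : Odd x := by
      have : Odd (a * x ^ 2) := hm ▸ ⟨j, by lia⟩
      exact (Int.odd_pow' two_ne_zero).1 (Int.odd_mul.1 this).2
    have hyodd : Odd y := by
      have : Odd (b * y ^ 2) := hn ▸ ⟨j - 1, by lia⟩
      exact (Int.odd_pow' two_ne_zero).1 (Int.odd_mul.1 this).2
    exact two hab ha hb (by linarith) (hxodd.mul hyodd)
  · obtain ⟨j, rfl⟩ := ht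
    have hcop : IsCoprime (j + 1) j := ⟨1, -1, by ring⟩
    rcases Int.even_or_odd u with ⟨v, rfl⟩ | hu
    · left
      obtain ⟨a, b, x, y, ha, hb, hm, hn, hab, -⟩ := exists_factorization_of_coprime_mul_eq
        (m := j + 1) (n := j) (u := v) (Δ := Δ) (by lia) (by lia) hcop (by lia) (by linarith)
      have heq : a * x ^ 2 - b * y ^ 2 = 1 := by linarith
      have ha1 : 1 < a := by
        refine lt_of_le_of_ne ha ?_
        rintro rfl
        obtain rfl : Δ = b := by lia
        have hx2 : 1 < |x| := by
          rw [← sq_lt_sq₀ zero_le_one (abs_nonneg x), sq_abs]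
          lia
        have := hmin' |x| y (by rw [sq_abs]; lia) hx2
        have := sq_abs x
        nlinarith
      have hb1 : 1 < b := by
        refine lt_of_le_of_ne hb ?_
        rintro rfl
        obtain rfl : Δ = a := by lia
        exact hneg ⟨y, x, by lia⟩
      rcases lt_trichotomy a b with hlt | rfl | hlt
      · exact ⟨a, b, hab, ha1, hlt, x, y, Or.inl heq⟩
      · exact absurd ⟨a, hab⟩ hns
      · exact ⟨b, a, by rw [hab, mul_comm], hb1, hlt, y, x, Or.inr (by linarith)⟩
    · right
      have h4 : (4 : ℤ) ∣ Δ := by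
        have hc : IsCoprime (4 : ℤ) (u ^ 2) := by
          obtain ⟨w, rfl⟩ := hu
          exact ⟨-(w ^ 2 + w), 1, by ring⟩
        exact hc.dvd_of_dvd_mul_right ⟨j ^ 2 + j, by linear_combination -hprop⟩
      obtain ⟨D, rfl⟩ := h4
      obtain ⟨a, b, x, y, ha, hb, hm, hn, hab, huxy⟩ := exists_factorization_of_coprime_mul_eq
        (m := j + 1) (n := j) (u := u) (Δ := D) (by lia) (by lia) hcop hy.ne' (by linarith)
      refine two (a := 2 * a) (b := 2 * b) (x := x) (y := y) (by rw [hab]; ring) (by lia)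
        (by lia) (by linarith) ?_
      rcases huxy with rfl | rfl
      · exact hu
      · exact odd_neg.1 hu

theorem not_negative_pell_of_solvable_one (hΔ : 2 < Δ) (hns : ¬IsSquare Δ) {a b x y σ : ℤ}
    (hab : Δ = a * b) (ha : 1 < a) (hb : 1 < b) (hσ : σ = 1 ∨ σ = -1)
    (h : a * x ^ 2 - b * y ^ 2 = σ) {r s : ℤ} : r ^ 2 - Δ * s ^ 2 ≠ -1 := by
  intro hrs
  have hσ2 : σ ^ 2 = 1 := by rcases hσ with rfl | rfl <;> rfl
  have hpos : 0 < a * x ^ 2 + b * y ^ 2 := by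
    have : 0 ≤ a * x ^ 2 := by positivity
    have : 0 ≤ b * y ^ 2 := by positivity
    lia
  obtain ⟨c, d, hcd, hX, -⟩ := exists_sq_of_negative_pell (by lia) hns hrs
    (x := a * x ^ 2 + b * y ^ 2) (y := 2 * x * y)
    (by rw [hab]; linear_combination (a * x ^ 2 - b * y ^ 2 + σ) * h + hσ2) hpos
  have hcop : IsCoprime (c ^ 2) Δ := by
    rcases hcd with hcd | hcd
    · exact ⟨1, -d ^ 2, by linear_combination hcd⟩
    · exact ⟨-1, d ^ 2, by linear_combination -hcd⟩
  have hc : c ^ 2 = a * x ^ 2 ∨ c ^ 2 = b * y ^ 2 := by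
    rcases hσ with rfl | rfl <;> rcases hcd with hcd | hcd <;> lia
  have notdvd {q : ℤ} (hq : 1 < q) (hqΔ : q ∣ Δ) (hqc : q ∣ c ^ 2) : False := by
    have := Int.isUnit_iff.1 (hcop.isUnit_of_dvd' hqc hqΔ)
    lia
  rcases hc with hc | hc
  · exact notdvd ha ⟨b, hab⟩ ⟨_, hc⟩
  · exact notdvd hb ⟨a, by rw [hab, mul_comm]⟩ ⟨_, hc⟩

theorem not_negative_pell_of_solvable_two (hΔ : 2 < Δ) (hns : ¬IsSquare Δ) {a b x y σ : ℤ}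
    (hab : Δ = a * b) (ha : 0 < a) (hb : 0 < b) (hσ : σ = 1 ∨ σ = -1)
    (h : a * x ^ 2 - b * y ^ 2 = 2 * σ) (hodd : Odd (x * y)) {r s : ℤ} :
    r ^ 2 - Δ * s ^ 2 ≠ -1 := by
  intro hrs
  have hσ2 : σ ^ 2 = 1 := by rcases hσ with rfl | rfl <;> rfl
  have hpos : 0 < b * y ^ 2 + σ := by
    have : 0 ≤ a * x ^ 2 := by positivity
    have : 0 ≤ b * y ^ 2 := by positivity
    lia
  obtain ⟨c, d, -, -, hY⟩ := exists_sq_of_negative_pell (by lia) hns hrs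
    (x := b * y ^ 2 + σ) (y := x * y) (by rw [hab]; linear_combination hσ2 - b * y ^ 2 * h) hpos
  rw [hY, mul_assoc] at hodd
  exact Int.not_even_iff_odd.2 hodd (even_two_mul _)

end Pell

/-- Mordell's criterion (Theorem 4.6): for a non-square integer `Δ > 2`, the minimal
period `p` of the (purely periodic) sequence of partial quotients of `√Δ` (after the
integer part) is even iff (1) `Δ = a·b` with `1 < a < b` and `a·x² - b·y² = ±1` has an
integer solution, or (2) `Δ = a·b` with `1 ≤ a < b` and `a·x² - b·y² = ±2` has an
integer solution with `x·y` odd. -/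
theorem stmt15 (Δ : ℤ) (hΔ : 2 < Δ) (hns : ¬ IsSquare Δ)
    (p : ℕ) (hp : 0 < p)
    (hper : ∀ n : ℕ, (GenContFract.of (Real.sqrt Δ)).partDens.get? (n + p)
      = (GenContFract.of (Real.sqrt Δ)).partDens.get? n)
    (hmin : ∀ q : ℕ, 0 < q →
      (∀ n : ℕ, (GenContFract.of (Real.sqrt Δ)).partDens.get? (n + q)
        = (GenContFract.of (Real.sqrt Δ)).partDens.get? n) → p ≤ q) :
    Even p ↔
      ((∃ a b : ℤ, Δ = a * b ∧ 1 < a ∧ a < b ∧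
          ∃ x y : ℤ, a * x ^ 2 - b * y ^ 2 = 1 ∨ a * x ^ 2 - b * y ^ 2 = -1) ∨
        (∃ a b : ℤ, Δ = a * b ∧ 1 ≤ a ∧ a < b ∧
          ∃ x y : ℤ, (a * x ^ 2 - b * y ^ 2 = 2 ∨ a * x ^ 2 - b * y ^ 2 = -2) ∧
            Odd (x * y))) := by
  have hirr : Irrational √(Δ : ℝ) := by
    rw [irrational_sqrt_intCast_iff]
    exact ⟨hns, by lia⟩
  have hfun : (∃ r s : ℤ, r ^ 2 - Δ * s ^ 2 = -1) ↔ Odd p := by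
    set f := fun n => (GenContFract.of √(Δ : ℝ)).partDens.get? n with hf
    have hf_per : Function.Periodic f p := hper
    constructor
    · rintro ⟨r, s, hrs⟩
      obtain ⟨q, hq, hT⟩ := exists_odd_period_of_negative_pell hΔ hirr hrs
      have hqper : Function.Periodic f q := by
        intro n
        simp only [hf, partDens_of_irrational hirr]
        rw [add_assoc, Function.iterate_add_apply, hT, ← Function.iterate_succ_apply]
      have hdvd : p ∣ q := by
        rw [Nat.dvd_iff_mod_eq_zero]
        by_contra hne
        refine (Nat.mod_lt q hp).not_ge (hmin (q % p) (Nat.pos_of_ne_zero hne) fun n => ?_)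
        change f (n + q % p) = f n
        rw [← hqper n, ← hf_per.nat_mul (q / p) (n + q % p), Nat.cast_id, add_assoc,
          mul_comm, Nat.mod_add_div]
      exact hq.of_dvd_nat hdvd
    · intro hodd
      have hT : contFracShift^[p + 1] √(Δ : ℝ) = contFracShift √(Δ : ℝ) := by
        refine eq_of_floor_iterate_contFracShift_eq fun n => ?_
        have := hper n
        rw [partDens_of_irrational hirr, partDens_of_irrational hirr, Option.some_inj,
          Int.cast_inj] at this
        rwa [← Function.iterate_add_apply, ← Function.iterate_succ_apply]
      obtain ⟨r, s, hrs⟩ := norm_eq_neg_one_pow_of_period (by lia) hirr hT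
      exact ⟨r, s, by rw [hrs, hodd.neg_one_pow]⟩
  rw [← Nat.not_odd_iff_even, ← hfun]
  refine ⟨solvable_of_not_negative_pell hΔ hns, ?_⟩
  rintro (⟨a, b, hab, ha, hlt, x, y, h⟩ | ⟨a, b, hab, ha, hlt, x, y, h, hodd⟩) ⟨r, s, hrs⟩
  · exact not_negative_pell_of_solvable_one hΔ hns hab ha (ha.trans hlt) h rfl hrs
  · rcases h with h | h
    · exact not_negative_pell_of_solvable_two hΔ hns hab (by lia) (by lia) (Or.inl rfl)
        h hodd hrs
    · exact not_negative_pell_of_solvable_two hΔ hns hab (by lia) (by lia) (Or.inr rfl)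
        h hodd hrs
end

section
/- Let a, b, c be integers with b² − 4ac = 20, and suppose that for all integers x, y the value 2a·x² + 2b·x·y + 2c·y² is never equal to −2. Then there exists a matrix P ∈ GL₂(ℤ) with Pᵀ · !![2a, b; b, 2c] · P = !![4, 2; 2, −4]. -/
open Matrix

theorem exists_abs_add_two_mul_le {a : ℤ} (ha : a ≠ 0) (b : ℤ) :
    ∃ k : ℤ, |b + 2 * a * k| ≤ |a| := by
  have hpos : 0 < |a| := abs_pos.mpr ha
  have h1 := Int.emod_nonneg (b + |a|) (by omega : 2 * |a| ≠ 0)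
  have h2 := Int.emod_lt_of_pos (b + |a|) (by omega : 0 < 2 * |a|)
  have h3 := Int.emod_add_mul_ediv (b + |a|) (2 * |a|)
  generalize (b + |a|) / (2 * |a|) = t at h3
  generalize (b + |a|) % (2 * |a|) = r at h1 h2 h3
  rcases abs_cases a with ⟨h, _⟩ | ⟨h, _⟩
  · refine ⟨-t, abs_le.mpr ⟨?_, ?_⟩⟩ <;> rw [h] at h3 h2 ⊢ <;> linarith
  · refine ⟨t, abs_le.mpr ⟨?_, ?_⟩⟩ <;> rw [h] at h3 h2 ⊢ <;> linarith

theorem reduced_of_discr_eq_twenty {a b c : ℤ} (hD : b ^ 2 - 4 * a * c = 20)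
    (hb : |b| ≤ |a|) (hac : |a| ≤ |c|) :
    (a = 1 ∧ b = 0 ∧ c = -5) ∨ (a = -1 ∧ b = 0 ∧ c = 5) ∨
      (a = 2 ∧ (b = 2 ∨ b = -2) ∧ c = -2) ∨ (a = -2 ∧ (b = 2 ∨ b = -2) ∧ c = 2) := by
  have hb2 : b ^ 2 ≤ a ^ 2 := sq_le_sq.mpr hb
  have hmul : a ^ 2 ≤ |a * c| := by
    rw [abs_mul, ← sq_abs, sq]
    exact mul_le_mul_of_nonneg_left hac (abs_nonneg a)
  have ha : a ^ 2 ≤ 5 := by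
    rcases abs_cases (a * c) with ⟨h, _⟩ | ⟨h, _⟩ <;> rw [h] at hmul <;> nlinarith
  have ha1 : a ≤ 2 := by nlinarith
  have ha2 : -2 ≤ a := by nlinarith
  have hb1 : b ≤ 2 := by nlinarith
  have hb3 : -2 ≤ b := by nlinarith
  interval_cases a <;> interval_cases b <;> omega

/-- Reduction of binary quadratic forms of discriminant `20`: such a form represents `-1`
or is equivalent to `2x² + 2xy - 2y²`. -/
theorem represents_neg_one_or_equiv_of_discr_eq_twenty (n : ℕ) :
    ∀ a b c : ℤ, a.natAbs ≤ n → b ^ 2 - 4 * a * c = 20 →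
      (∃ x y : ℤ, a * x ^ 2 + b * x * y + c * y ^ 2 = -1) ∨
      ∃ p q r s : ℤ, IsUnit (p * s - q * r) ∧ a * p ^ 2 + b * p * r + c * r ^ 2 = 2 ∧
        2 * a * p * q + b * (p * s + q * r) + 2 * c * r * s = 2 ∧
        a * q ^ 2 + b * q * s + c * s ^ 2 = -2 := by
  induction n with
  | zero =>
    intro a b c ha hD
    obtain rfl : a = 0 := by omega
    have h1 : b ≤ 4 := by nlinarith
    have h2 : -4 ≤ b := by nlinarith
    interval_cases b <;> omega
  | succ n ih =>
    intro a b c han hD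
    by_cases ha : a = 0
    · exact ih a b c (by simp [ha]) hD
    obtain ⟨k, hk⟩ := exists_abs_add_two_mul_le ha b
    have hD' : (b + 2 * a * k) ^ 2 - 4 * (a * k ^ 2 + b * k + c) * a = 20 := by
      linear_combination hD
    have key : (∃ x y : ℤ, (a * k ^ 2 + b * k + c) * x ^ 2 + (b + 2 * a * k) * x * y
          + a * y ^ 2 = -1) ∨
        ∃ p q r s : ℤ, IsUnit (p * s - q * r) ∧
          (a * k ^ 2 + b * k + c) * p ^ 2 + (b + 2 * a * k) * p * r + a * r ^ 2 = 2 ∧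
          2 * (a * k ^ 2 + b * k + c) * p * q + (b + 2 * a * k) * (p * s + q * r)
            + 2 * a * r * s = 2 ∧
          (a * k ^ 2 + b * k + c) * q ^ 2 + (b + 2 * a * k) * q * s + a * s ^ 2 = -2 := by
      generalize b + 2 * a * k = b' at *
      generalize a * k ^ 2 + b * k + c = c' at *
      by_cases hc : |a| ≤ |c'|
      · rcases reduced_of_discr_eq_twenty (by linear_combination hD') hk hc with
          ⟨rfl, rfl, rfl⟩ | ⟨rfl, rfl, rfl⟩ | ⟨rfl, rfl | rfl, rfl⟩ | ⟨rfl, rfl | rfl, rfl⟩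
        · exact .inl ⟨1, 2, by norm_num⟩
        · exact .inl ⟨0, 1, by norm_num⟩
        · exact .inr ⟨0, 1, 1, 0, by norm_num⟩
        · exact .inr ⟨0, -1, 1, 0, by norm_num⟩
        · exact .inr ⟨1, 0, 0, 1, by norm_num⟩
        · exact .inr ⟨1, 0, 0, -1, by norm_num⟩
      · rw [Int.abs_eq_natAbs, Int.abs_eq_natAbs] at hc
        exact ih c' b' a (by omega) hD'
    rcases key with ⟨x, y, h⟩ | ⟨p, q, r, s, hu, h1, h2, h3⟩
    · exact .inl ⟨k * x + y, x, by linear_combination h⟩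
    · refine .inr ⟨k * p + r, k * q + s, p, q, ?_, by linear_combination h1,
        by linear_combination h2, by linear_combination h3⟩
      rw [show (k * p + r) * q - (k * q + s) * p = -(p * s - q * r) by ring]
      exact hu.neg

/-- Step in Theorem 5.2: an even binary lattice of discriminant `-20` which does not
represent `-2` is isomorphic to `!![4, 2; 2, -4]`, the Picard lattice of the K3
surfaces with the Cayley–Oguiso fixed-point-free automorphism. -/
theorem stmt16 (a b c : ℤ) (hD : b ^ 2 - 4 * a * c = 20)
    (h2 : ∀ x y : ℤ, 2 * a * x ^ 2 + 2 * b * x * y + 2 * c * y ^ 2 ≠ -2) :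
    ∃ P : GL (Fin 2) ℤ,
      (P : Matrix (Fin 2) (Fin 2) ℤ)ᵀ * !![2 * a, b; b, 2 * c] *
        (P : Matrix (Fin 2) (Fin 2) ℤ) = !![4, 2; 2, -4] := by
  rcases represents_neg_one_or_equiv_of_discr_eq_twenty a.natAbs a b c le_rfl hD with
    ⟨x, y, h⟩ | ⟨p, q, r, s, hu, h11, h12, h22⟩
  · exact absurd (by linear_combination 2 * h) (h2 x y)
  · refine ⟨GeneralLinearGroup.mk'' !![p, q; r, s] (by rwa [det_fin_two_of]), ?_⟩
    change !![p, q; r, s]ᵀ * !![2 * a, b; b, 2 * c] * !![p, q; r, s] = _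
    ext i j
    fin_cases i <;> fin_cases j <;> simp [Matrix.mul_apply, Fin.sum_univ_two]
    · linear_combination 2 * h11
    · linear_combination h12
    · linear_combination h12
    · linear_combination 2 * h22
end

section
/- Let D be a positive integer that is not a perfect square, and let δ ∈ {0, 1} with δ ≡ D (mod 2). Let a, b, c be integers with b² − 4ac = D, and suppose there exist integers x₀, y₀ with 2a·x₀² + 2b·x₀·y₀ + 2c·y₀² = −2. Then there exists a matrix P ∈ GL₂(ℤ) with Pᵀ · !![2a, b; b, 2c] · P = !![−2, δ; δ, (D − δ²)/2]. -/
open Matrix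

/-- If `a * x ^ 2 + b * x * y + c * y ^ 2 = -1`, then `(x, y)` and
`(c * y, -(a * x + b * y)) + k • (x, y)` form a basis of `ℤ ^ 2`, and this is the Gram matrix of the
lattice in that basis. -/
theorem exists_GL_gram_eq_of_represents_neg_one (a b c x y : ℤ)
    (h : a * x ^ 2 + b * x * y + c * y ^ 2 = -1) (k : ℤ) :
    ∃ P : GL (Fin 2) ℤ,
      (P : Matrix (Fin 2) (Fin 2) ℤ)ᵀ * !![2 * a, b; b, 2 * c] *
        (P : Matrix (Fin 2) (Fin 2) ℤ) =
        !![-2, b - 2 * k; b - 2 * k, 2 * (b * k - k ^ 2 - a * c)] := by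
  have hdet : !![x, c * y + k * x; y, -(a * x + b * y) + k * y].det = 1 := by
    rw [det_fin_two_of]
    linear_combination -h
  refine ⟨GeneralLinearGroup.mk'' _ (hdet ▸ isUnit_one), ?_⟩
  change !![x, c * y + k * x; y, -(a * x + b * y) + k * y]ᵀ * !![2 * a, b; b, 2 * c] *
    !![x, c * y + k * x; y, -(a * x + b * y) + k * y] = _
  ext i j
  fin_cases i <;> fin_cases j <;> simp [mul_apply, Fin.sum_univ_two]
  · linear_combination 2 * h
  · linear_combination (2 * k - b) * h
  · linear_combination (2 * k - b) * h
  · linear_combination 2 * (a * c - b * k + k ^ 2) * h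

/-- Key step of Lemma 2.5: an even binary lattice of signature `(1,1)` and
discriminant `-D` (with `D` not a square) that represents `-2` is isomorphic to
`L₀ = !![-2, δ; δ, (D - δ²)/2]`, where `δ ∈ {0, 1}` and `δ ≡ D (mod 2)`. -/
theorem stmt18 (D : ℤ) (hDpos : 0 < D) (hns : ¬ IsSquare D)
    (δ : ℤ) (hδ : δ = 0 ∨ δ = 1) (hδD : δ % 2 = D % 2)
    (a b c : ℤ) (hD : b ^ 2 - 4 * a * c = D)
    (hrep : ∃ x₀ y₀ : ℤ, 2 * a * x₀ ^ 2 + 2 * b * x₀ * y₀ + 2 * c * y₀ ^ 2 = -2) :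
    ∃ P : GL (Fin 2) ℤ,
      (P : Matrix (Fin 2) (Fin 2) ℤ)ᵀ * !![2 * a, b; b, 2 * c] *
        (P : Matrix (Fin 2) (Fin 2) ℤ) = !![-2, δ; δ, (D - δ ^ 2) / 2] := by
  obtain ⟨x, y, hxy⟩ := hrep
  have hbD : b % 2 = D % 2 := by
    rw [← hD, mul_assoc, Int.sub_emod, Int.mul_emod 4, pow_two, Int.mul_emod b]
    rcases Int.emod_two_eq_zero_or_one b with hb | hb <;> simp [hb]
  obtain ⟨k, hk⟩ : (2 : ℤ) ∣ b - δ := by lia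
  obtain rfl : δ = b - 2 * k := by linarith
  have hlast : (D - (b - 2 * k) ^ 2) / 2 = 2 * (b * k - k ^ 2 - a * c) :=
    Int.ediv_eq_of_eq_mul_right two_ne_zero (by linear_combination -hD)
  rw [hlast]
  exact exists_GL_gram_eq_of_represents_neg_one a b c x y (by linarith) k
end
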